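/- arXiv:0812.3631 — 3 statements merged into one kernel-verified Lean document; each statement's English description precedes it below -/
import Mathlib

section
/- Let B be a finite-dimensional commutative ℚ-algebra with a ℚ-linear functional d : B → ℚ whose trace pairing on B is nondegenerate. Let J be an ideal of B, let I = J^⊥ = {x ∈ B : d(xj) = 0 for all j ∈ J}, and let λ ∈ I. Assume the induced bilinear form on B/J given by (a + J, b + J) ↦ d(abλ) is nondegenerate. Then the multiplication map B/J → I sending a + J to aλ is a well-defined ℚ-linear bijection; in particular I = Bλ, and I is a free module of rank one over B/J generated by λ. -/
/-- Under the hypotheses of Statement 3, the multiplication map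
`B ⧸ J → I`, `a + J ↦ a * l`, is a well-defined ℚ-linear bijection onto
`I = J^⊥ = {x : ∀ j ∈ J, d (x * j) = 0}`; in particular `I = B·l`, so `I` is a free
`B ⧸ J`-module of rank one generated by `l`. Expressed elementwise:
well-definedness (`J · l = 0`), the map lands in `I`, injectivity, and surjectivity. -/
theorem stmt_4 {B : Type*} [CommRing B] [Algebra ℚ B] [FiniteDimensional ℚ B]
    (d : B →ₗ[ℚ] ℚ)
    (hnd : ∀ a : B, (∀ b : B, d (a * b) = 0) → a = 0)
    (J : Ideal B) (l : B)
    (hl : ∀ j ∈ J, d (l * j) = 0)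
    (hquot : ∀ a : B, (∀ b : B, d (a * b * l) = 0) → a ∈ J)
    (I : Set B) (hI : ∀ x : B, x ∈ I ↔ ∀ j ∈ J, d (x * j) = 0) :
    (∀ j ∈ J, j * l = 0) ∧
    (∀ a : B, a * l ∈ I) ∧
    (∀ a b : B, a * l = b * l → a - b ∈ J) ∧
    (∀ x ∈ I, ∃ a : B, x = a * l) := by
  have h1 : ∀ j ∈ J, j * l = 0 := by
    intro j hj
    apply hnd
    intro b
    have := hl (j * b) (J.mul_mem_right b hj)
    rwa [show j * l * b = l * (j * b) by ring]
  refine ⟨h1, ?_, ?_, ?_⟩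
  · intro a
    rw [hI]
    intro j hj
    rw [show a * l * j = a * (j * l) by ring, h1 j hj, mul_zero, map_zero]
  · intro a b hab
    apply hquot
    intro c
    rw [show (a - b) * c * l = c * (a * l - b * l) by ring, hab, sub_self, mul_zero, map_zero]
  · intro x hx
    by_contra hne
    have hx' : x ∉ LinearMap.range (LinearMap.mulRight ℚ l) := by
      rintro ⟨a, ha⟩
      exact hne ⟨a, by simpa using ha.symm⟩
    obtain ⟨f, hfx, hf⟩ := Submodule.exists_le_ker_of_notMem hx'
    let T : B →ₗ[ℚ] Module.Dual ℚ B := (LinearMap.mul ℚ B).compr₂ d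
    have hT : Function.Injective T := by
      rw [injective_iff_map_eq_zero]
      intro a ha
      apply hnd
      intro b
      exact LinearMap.congr_fun ha b
    have hS : Function.Surjective T :=
      (LinearMap.injective_iff_surjective_of_finrank_eq_finrank
        Subspace.dual_finrank_eq.symm).1 hT
    obtain ⟨c, hc⟩ := hS f
    have hcf : ∀ y, d (c * y) = f y := fun y => LinearMap.congr_fun hc y
    have hcJ : c ∈ J := by
      apply hquot
      intro b
      rw [mul_assoc, hcf]
      exact hf ⟨b, by simp⟩
    apply hfx
    rw [← hcf, mul_comm]
    exact (hI x).1 hx c hcJ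
end

section
/- Let B be a finite-dimensional commutative ℚ-algebra with a ℚ-linear functional d : B → ℚ whose trace pairing on B is nondegenerate. Let J be an ideal of B, let I = J^⊥ = {x ∈ B : d(xj) = 0 for all j ∈ J}, and let λ ∈ I. Assume the induced bilinear form on B/J given by (a + J, b + J) ↦ d(abλ) is nondegenerate. Then the pairing (B/J) × I → ℚ, (b + J, x) ↦ d(bx), is perfect: both induced linear maps B/J → I* and I → (B/J)* are bijective. -/
/-- Under the hypotheses of Statement 3, the pairing
`(B ⧸ J) × I → ℚ`, `(b + J, x) ↦ d (b * x)`, is perfect: both induced linear maps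
`B ⧸ J → I*` and `I → (B ⧸ J)*` are bijective. -/
theorem stmt_5 {B : Type*} [CommRing B] [Algebra ℚ B] [FiniteDimensional ℚ B]
    (d : B →ₗ[ℚ] ℚ)
    (hnd : ∀ a : B, (∀ b : B, d (a * b) = 0) → a = 0)
    (J : Ideal B) (l : B)
    (hl : ∀ j ∈ J, d (l * j) = 0)
    (hquot : ∀ a : B, (∀ b : B, d (a * b * l) = 0) → a ∈ J)
    (I : Submodule ℚ B) (hI : ∀ x : B, x ∈ I ↔ ∀ j ∈ J, d (x * j) = 0)
    (p : (B ⧸ J) →ₗ[ℚ] I →ₗ[ℚ] ℚ)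
    (hp : ∀ (b : B) (x : I), p (Ideal.Quotient.mk J b) x = d (b * (x : B))) :
    Function.Bijective p ∧ Function.Bijective p.flip := by
  have h1 : Function.Injective p := by
    rw [injective_iff_map_eq_zero]
    intro a ha
    obtain ⟨b, rfl⟩ := Ideal.Quotient.mk_surjective a
    rw [Ideal.Quotient.eq_zero_iff_mem]
    apply hquot
    intro c
    have hc : c * l ∈ I := by
      rw [hI]
      intro j hj
      have := hl (c * j) (J.mul_mem_left c hj)
      rwa [show c * l * j = l * (c * j) by ring]
    have h := hp b ⟨c * l, hc⟩
    rw [ha] at h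
    rw [mul_assoc]
    exact h.symm
  have h2 : Function.Injective p.flip := by
    rw [injective_iff_map_eq_zero]
    intro x hx
    apply Subtype.ext
    apply hnd
    intro b
    have h := hp b x
    rw [← LinearMap.flip_apply, hx] at h
    rw [mul_comm]
    exact h.symm
  have : FiniteDimensional ℚ (B ⧸ J) :=
    Module.Finite.of_surjective (Ideal.Quotient.mkₐ ℚ J).toLinearMap
      Ideal.Quotient.mk_surjective
  have h := LinearMap.IsPerfPair.of_injective h1 h2
  exact ⟨h.bijective_left, h.bijective_right⟩
end

section
/- Let B be a commutative ℚ-algebra with a ℚ-linear functional d : B → ℚ. Let ι be a finite index set and for each i ∈ ι let C_i be a commutative ℚ-algebra, φ_i : B → C_i a ℚ-algebra homomorphism, and f_i : C_i → B a ℚ-linear map such that: (i) the projection formula f_i(φ_i(b)·c) = b·f_i(c) holds for all b ∈ B, c ∈ C_i; and (ii) the trace pairing on C_i associated to the functional d ∘ f_i is nondegenerate. Let I' = {x ∈ B : φ_i(x) = 0 for all i ∈ ι}. Assume moreover that for every x ∈ I', if d(bx) = 0 for all b ∈ B then x = 0. Then the trace pairing on B associated to d is nondegenerate. -/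
/-- Let `B` be a commutative ℚ-algebra with linear functional `d`, and for
each `i` in a finite index set let `φ i : B → C i` be an algebra homomorphism and
`f i : C i → B` a linear map satisfying the projection formula, such that the trace
pairing on `C i` associated to `d ∘ f i` is nondegenerate. If every `x` with `φ i x = 0`
for all `i` and `d (b * x) = 0` for all `b` vanishes, then the trace pairing on `B`
associated to `d` is nondegenerate. -/
theorem stmt_7 {B : Type*} [CommRing B] [Algebra ℚ B]
    (d : B →ₗ[ℚ] ℚ)
    {ι : Type*} [Finite ι]
    (C : ι → Type*) [∀ i, CommRing (C i)] [∀ i, Algebra ℚ (C i)]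
    (φ : ∀ i, B →ₐ[ℚ] C i) (f : ∀ i, C i →ₗ[ℚ] B)
    (proj : ∀ (i : ι) (b : B) (c : C i), f i (φ i b * c) = b * f i c)
    (nondeg : ∀ (i : ι) (c : C i), (∀ c' : C i, d (f i (c * c')) = 0) → c = 0)
    (hI' : ∀ x : B, (∀ i : ι, φ i x = 0) → (∀ b : B, d (b * x) = 0) → x = 0) :
    ∀ a : B, (∀ b : B, d (a * b) = 0) → a = 0 := by
  intro a ha
  refine hI' a (fun i => nondeg i _ fun c' => ?_) (fun b => ?_)
  · rw [proj]
    exact ha _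
  · rw [mul_comm]
    exact ha b
end
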